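/- Suppose ṡ(r) ≤ 0 for all r ∈ [0,R] (upsloping bottom). Then there exist constants ε > 0 and c > 0, depending only on α, q, λ, R, on upper bounds for s and |ṡ| on [0,R], and on upper bounds for β and its first-order partial derivatives on 𝒟, such that: if (1/α)·max_{0≤r≤R} s(r) ≤ ε, then every complex-valued function v, smooth on an open neighborhood of 𝒟, which satisfies the wide-angle equation (1 + q·β)·v_r + α²·q·v_{zzr} = iλ·(α²·v_zz + β·v) on 𝒟 together with the boundary conditions v(r,0) = 0 and v(r,s(r)) = 0 for all r ∈ [0,R], obeys the H²-stability estimate ‖v(r,·)‖₂ ≤ c·‖v(0,·)‖₂ for all r ∈ [0,R]. -/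

import Mathlib

open Complex Set MeasureTheory intervalIntegral

/-- Partial derivative in the first (range) variable. -/
noncomputable def pr (f : ℝ → ℝ → ℂ) (r z : ℝ) : ℂ := deriv (fun t => f t z) r

/-- Partial derivative in the second (depth) variable. -/
noncomputable def pz (f : ℝ → ℝ → ℂ) (r z : ℝ) : ℂ := deriv (fun w => f r w) z

/-- The waveguide domain `𝒟 = {(r,z) : 0 ≤ r ≤ R, 0 ≤ z ≤ s(r)}`. -/
def wgDom (R : ℝ) (s : ℝ → ℝ) : Set (ℝ × ℝ) :=
  {p : ℝ × ℝ | p.1 ∈ Icc 0 R ∧ p.2 ∈ Icc 0 (s p.1)}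

/-- Smoothness on an open neighborhood of the domain `𝒟`. -/
def SmoothNearDom (R : ℝ) (s : ℝ → ℝ) (f : ℝ → ℝ → ℂ) : Prop :=
  ∃ U : Set (ℝ × ℝ), IsOpen U ∧ wgDom R s ⊆ U ∧
    ContDiffOn ℝ (⊤ : ℕ∞) (fun p : ℝ × ℝ => f p.1 p.2) U

/-- The range-dependent `H²` norm
`‖w(r,·)‖₂ = (‖w(r,·)‖² + ‖w_z(r,·)‖² + ‖w_zz(r,·)‖²)^{1/2}` on `[0,s(r)]`. -/
noncomputable def H2norm (s : ℝ → ℝ) (w : ℝ → ℝ → ℂ) (r : ℝ) : ℝ :=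
  Real.sqrt ((∫ z in (0:ℝ)..(s r), ‖w r z‖ ^ 2)
    + (∫ z in (0:ℝ)..(s r), ‖pz w r z‖ ^ 2)
    + (∫ z in (0:ℝ)..(s r), ‖pz (pz w) r z‖ ^ 2))

/-- A function with vanishing mean over `[0, b]` is bounded by the `L¹` norm of its
derivative. -/
lemma norm_le_integral_norm_deriv_of_integral_eq_zero {b : ℝ} (hb : 0 < b) {f f' : ℝ → ℂ}
    (hf : ∀ z ∈ Icc 0 b, HasDerivAt f (f' z) z) (hf' : ContinuousOn f' (Icc 0 b))
    (h0 : ∫ z in (0:ℝ)..b, f z = 0) {z : ℝ} (hz : z ∈ Icc 0 b) :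
    ‖f z‖ ≤ ∫ t in (0:ℝ)..b, ‖f' t‖ := by
  have hint : IntervalIntegrable f volume 0 b :=
    ContinuousOn.intervalIntegrable_of_Icc hb.le (HasDerivAt.continuousOn hf)
  have key : ∀ y ∈ Icc 0 b, ‖f z - f y‖ ≤ ∫ t in (0:ℝ)..b, ‖f' t‖ := by
    intro y hy
    have hsub : uIcc y z ⊆ Icc 0 b := uIcc_subset_Icc hy hz
    rw [← integral_eq_sub_of_hasDerivAt (fun x hx => hf x (hsub hx))
      (hf'.mono hsub).intervalIntegrable]
    refine norm_integral_le_abs_integral_norm.trans ?_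
    have hnn : 0 ≤ ∫ t in (0:ℝ)..b, ‖f' t‖ :=
      intervalIntegral.integral_nonneg hb.le fun _ _ => norm_nonneg _
    rw [← abs_of_nonneg hnn]
    refine abs_integral_mono_interval ?_ (ae_of_all _ fun _ => norm_nonneg _)
      (ContinuousOn.intervalIntegrable_of_Icc hb.le hf'.norm)
    rw [uIoc_of_le hb.le]
    exact Ioc_subset_Ioc (le_min hy.1 hz.1) (max_le hy.2 hz.2)
  have hsm : ∫ y in (0:ℝ)..b, (f z - f y) = (b : ℂ) * f z := by
    rw [intervalIntegral.integral_sub (by simp) hint, h0]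
    simp
  have hle := norm_integral_le_of_norm_le_const (a := 0) (b := b) (f := fun y => f z - f y)
    (C := ∫ t in (0:ℝ)..b, ‖f' t‖) fun y hy => key y <| by
      rw [uIoc_of_le hb.le] at hy; exact Ioc_subset_Icc_self hy
  rw [hsm, norm_mul, Complex.norm_real, Real.norm_eq_abs, sub_zero, abs_of_pos hb, mul_comm] at hle
  exact le_of_mul_le_mul_right hle hb

/-- A function vanishing at both endpoints of `[0, b]` and its first derivative are controlled
by the `L¹` norm of the second derivative. -/
lemma norm_le_of_dirichlet {b : ℝ} (hb : 0 < b) {f f' f'' : ℝ → ℂ}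
    (hf : ∀ z ∈ Icc 0 b, HasDerivAt f (f' z) z) (hf' : ∀ z ∈ Icc 0 b, HasDerivAt f' (f'' z) z)
    (hf'' : ContinuousOn f'' (Icc 0 b)) (h0 : f 0 = 0) (h1 : f b = 0) {z : ℝ}
    (hz : z ∈ Icc 0 b) :
    ‖f' z‖ ≤ (∫ t in (0:ℝ)..b, ‖f'' t‖) ∧ ‖f z‖ ≤ b * ∫ t in (0:ℝ)..b, ‖f'' t‖ := by
  have hc' : ContinuousOn f' (Icc 0 b) := HasDerivAt.continuousOn hf'
  have hsub : uIcc 0 b ⊆ Icc 0 b := uIcc_subset_Icc ⟨le_rfl, hb.le⟩ ⟨hb.le, le_rfl⟩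
  have hmean : ∫ z in (0:ℝ)..b, f' z = 0 := by
    rw [integral_eq_sub_of_hasDerivAt (fun x hx => hf x (hsub hx))
      (hc'.mono hsub).intervalIntegrable, h0, h1, sub_zero]
  have hd : ∀ y ∈ Icc 0 b, ‖f' y‖ ≤ ∫ t in (0:ℝ)..b, ‖f'' t‖ := fun y hy =>
    norm_le_integral_norm_deriv_of_integral_eq_zero hb hf' hf'' hmean hy
  refine ⟨hd z hz, ?_⟩
  have hsubz : uIcc 0 z ⊆ Icc 0 b := uIcc_subset_Icc ⟨le_rfl, hb.le⟩ hz
  have hnn : 0 ≤ ∫ t in (0:ℝ)..b, ‖f'' t‖ :=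
    intervalIntegral.integral_nonneg hb.le fun _ _ => norm_nonneg _
  have hfz : f z = ∫ t in (0:ℝ)..z, f' t := by
    rw [integral_eq_sub_of_hasDerivAt (fun x hx => hf x (hsubz hx))
      (hc'.mono hsubz).intervalIntegrable, h0, sub_zero]
  have := norm_integral_le_of_norm_le_const (a := 0) (b := z) (f := f')
    fun y hy => hd y (hsubz (uIoc_subset_uIcc hy))
  rw [sub_zero, abs_of_nonneg hz.1] at this
  rw [hfz, mul_comm]
  exact this.trans (mul_le_mul_of_nonneg_left hz.2 hnn)

/-- The Cauchy–Schwarz inequality against the constant function on `[0, b]`. -/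
lemma sq_integral_le_mul_integral_sq {b : ℝ} (hb : 0 < b) {f : ℝ → ℝ}
    (hf : ContinuousOn f (Icc 0 b)) :
    (∫ z in (0:ℝ)..b, f z) ^ 2 ≤ b * ∫ z in (0:ℝ)..b, f z ^ 2 := by
  set L := ∫ z in (0:ℝ)..b, f z with hL
  have h : 0 ≤ ∫ z in (0:ℝ)..b, (f z - L / b) ^ 2 :=
    intervalIntegral.integral_nonneg hb.le fun _ _ => sq_nonneg _
  have i1 : IntervalIntegrable f volume 0 b := ContinuousOn.intervalIntegrable_of_Icc hb.le hf
  have i2 : IntervalIntegrable (fun z => f z ^ 2) volume 0 b :=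
    ContinuousOn.intervalIntegrable_of_Icc hb.le (hf.pow 2)
  have e : ∀ z, (f z - L / b) ^ 2 = f z ^ 2 - (2 * (L / b)) * f z + (L / b) ^ 2 :=
    fun z => by ring
  simp only [e] at h
  rw [intervalIntegral.integral_add (i2.sub (i1.const_mul _)) (by simp),
    intervalIntegral.integral_sub i2 (i1.const_mul _), intervalIntegral.integral_const_mul,
    ← hL, intervalIntegral.integral_const, smul_eq_mul, sub_zero] at h
  have h' := mul_nonneg hb.le h
  have : b * ((∫ z in (0:ℝ)..b, f z ^ 2) - 2 * (L / b) * L + b * (L / b) ^ 2)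
      = b * (∫ z in (0:ℝ)..b, f z ^ 2) - L ^ 2 := by
    field_simp; ring
  linarith

/-- Energy estimate for a pair `v, u` on `[0, b]` such that `v` vanishes at the endpoints, `u`
vanishes at `0`, its value at `b` is controlled by `v'`, and `u''` is controlled pointwise by
`v''`, `v` and `u`, with a small coefficient in front of `u`. -/
lemma exists_integral_mul_le_of_dirichlet {S a e Γ D : ℝ} (hS : 0 ≤ S) (ha : 0 ≤ a) (he : 0 ≤ e)
    (hΓ : 0 ≤ Γ) (hD : 0 ≤ D) (hsmall : Γ * S ^ 2 ≤ 1 / 2) :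
    ∃ K : ℝ, 0 ≤ K ∧ ∀ b : ℝ, 0 < b → b ≤ S → ∀ v v' v'' u u' u'' : ℝ → ℂ,
      (∀ z ∈ Icc 0 b, HasDerivAt v (v' z) z) → (∀ z ∈ Icc 0 b, HasDerivAt v' (v'' z) z) →
      ContinuousOn v'' (Icc 0 b) →
      (∀ z ∈ Icc 0 b, HasDerivAt u (u' z) z) → (∀ z ∈ Icc 0 b, HasDerivAt u' (u'' z) z) →
      ContinuousOn u'' (Icc 0 b) →
      v 0 = 0 → v b = 0 → u 0 = 0 → ‖u b‖ ≤ D * ‖v' b‖ →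
      (∀ z ∈ Icc 0 b, ‖u'' z‖ ≤ a * ‖v'' z‖ + e * ‖v z‖ + Γ * ‖u z‖) →
      ∫ z in (0:ℝ)..b, 2 * (‖u'' z‖ * ‖v'' z‖) ≤ K * ∫ z in (0:ℝ)..b, ‖v'' z‖ ^ 2 := by
  set C₁ : ℝ := 2 * (D + S * a + S ^ 3 * e) with hC₁
  set C₂ : ℝ := e * S + Γ * C₁ with hC₂
  have hC₁0 : 0 ≤ C₁ := by positivity
  have hC₂0 : 0 ≤ C₂ := by positivity
  refine ⟨2 * a + 2 * C₂ * S, by positivity, ?_⟩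
  intro b hb hbS v v' v'' u u' u'' hv hv' hv'' hu hu' hu'' hv0 hvb hu0 hub hle
  set L := ∫ t in (0:ℝ)..b, ‖v'' t‖ with hL
  have hL0 : 0 ≤ L := intervalIntegral.integral_nonneg hb.le fun _ _ => norm_nonneg _
  have hbv : ∀ z ∈ Icc 0 b, ‖v z‖ ≤ b * L := fun z hz =>
    (norm_le_of_dirichlet hb hv hv' hv'' hv0 hvb hz).2
  have hbv' : ‖v' b‖ ≤ L := (norm_le_of_dirichlet hb hv hv' hv'' hv0 hvb ⟨hb.le, le_rfl⟩).1
  have iv : IntervalIntegrable (fun z => ‖v'' z‖) volume 0 b :=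
    ContinuousOn.intervalIntegrable_of_Icc hb.le hv''.norm
  have iu : IntervalIntegrable (fun z => ‖u'' z‖) volume 0 b :=
    ContinuousOn.intervalIntegrable_of_Icc hb.le hu''.norm
  have hubL : ‖u b‖ ≤ D * L := hub.trans (mul_le_mul_of_nonneg_left hbv' hD)
  obtain ⟨x, hx, hmax⟩ := isCompact_Icc.exists_isMaxOn (nonempty_Icc.2 hb.le)
    (HasDerivAt.continuousOn hu).norm
  set M := ‖u x‖ with hM
  have hM' : ∀ z ∈ Icc 0 b, ‖u z‖ ≤ M := fun z hz => hmax hz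
  have hM0 : 0 ≤ M := norm_nonneg _
  have hpt : ∀ z ∈ Icc 0 b, ‖u'' z‖ ≤ a * ‖v'' z‖ + (e * (b * L) + Γ * M) := fun z hz => by
    have h1 := mul_le_mul_of_nonneg_left (hbv z hz) he
    have h2 := mul_le_mul_of_nonneg_left (hM' z hz) hΓ
    linarith [hle z hz]
  have hJ : ∫ t in (0:ℝ)..b, ‖u'' t‖ ≤ a * L + b * (e * (b * L) + Γ * M) := by
    have := intervalIntegral.integral_mono_on hb.le iu ((iv.const_mul a).add (by simp)) hpt
    rwa [intervalIntegral.integral_add (iv.const_mul a) (by simp),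
      intervalIntegral.integral_const_mul, ← hL, intervalIntegral.integral_const, smul_eq_mul,
      sub_zero] at this
  have hg : ‖u x - (x : ℂ) * (u b / b)‖ ≤ b * ∫ t in (0:ℝ)..b, ‖u'' t‖ := by
    have hid : ∀ z : ℝ, HasDerivAt (fun y : ℝ => (y : ℂ) * (u b / b)) (u b / b) z := fun z => by
      simpa using (Complex.ofRealCLM.hasDerivAt (x := z)).mul_const (u b / b)
    have hbC : (b : ℂ) ≠ 0 := by exact_mod_cast hb.ne'
    refine (norm_le_of_dirichlet (f := fun z => u z - (z : ℂ) * (u b / b))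
      (f' := fun z => u' z - u b / b) hb (fun z hz => (hu z hz).sub (hid z))
      (fun z hz => (hu' z hz).sub_const _) hu'' (by simp [hu0]) ?_ hx).2
    field_simp
    simp
  have hlin : ‖(x : ℂ) * (u b / b)‖ ≤ D * L := by
    rw [norm_mul, norm_div, Complex.norm_real, Complex.norm_real, Real.norm_eq_abs,
      Real.norm_eq_abs, abs_of_pos hb, abs_of_nonneg hx.1]
    calc x * (‖u b‖ / b) ≤ b * (‖u b‖ / b) :=
          mul_le_mul_of_nonneg_right hx.2 (by positivity)
      _ = ‖u b‖ := by field_simp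
      _ ≤ D * L := hubL
  have hMle : M ≤ C₁ * L := by
    have h1 : M ≤ ‖u x - (x : ℂ) * (u b / b)‖ + ‖(x : ℂ) * (u b / b)‖ := by
      simpa [hM] using norm_add_le (u x - (x : ℂ) * (u b / b)) ((x : ℂ) * (u b / b))
    have h2 : b * ∫ t in (0:ℝ)..b, ‖u'' t‖ ≤ S * (a * L + S * (e * (S * L) + Γ * M)) := by
      refine (mul_le_mul_of_nonneg_left hJ hb.le).trans ?_
      gcongr
    have h3 : Γ * S ^ 2 * M ≤ 1 / 2 * M := mul_le_mul_of_nonneg_right hsmall hM0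
    rw [hC₁]
    nlinarith
  have hpt' : ∀ z ∈ Icc 0 b,
      2 * (‖u'' z‖ * ‖v'' z‖) ≤ 2 * a * ‖v'' z‖ ^ 2 + 2 * C₂ * L * ‖v'' z‖ := fun z hz => by
    have h1 : ‖u'' z‖ ≤ a * ‖v'' z‖ + C₂ * L := by
      have h2 : e * (b * L) + Γ * M ≤ e * (S * L) + Γ * (C₁ * L) := by gcongr
      calc _ ≤ _ := hpt z hz
        _ ≤ a * ‖v'' z‖ + (e * (S * L) + Γ * (C₁ * L)) := by linarith
        _ = _ := by rw [hC₂]; ring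
    have := mul_le_mul_of_nonneg_right h1 (norm_nonneg (v'' z))
    linarith
  have iv2 : IntervalIntegrable (fun z => ‖v'' z‖ ^ 2) volume 0 b :=
    ContinuousOn.intervalIntegrable_of_Icc hb.le (hv''.norm.pow 2)
  have iuv : IntervalIntegrable (fun z => 2 * (‖u'' z‖ * ‖v'' z‖)) volume 0 b :=
    ContinuousOn.intervalIntegrable_of_Icc hb.le
      (continuousOn_const.mul (hu''.norm.mul hv''.norm))
  have hfin := intervalIntegral.integral_mono_on hb.le iuv
    ((iv2.const_mul (2 * a)).add (iv.const_mul (2 * C₂ * L))) hpt'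
  rw [intervalIntegral.integral_add (iv2.const_mul _) (iv.const_mul _),
    intervalIntegral.integral_const_mul (2 * a), intervalIntegral.integral_const_mul (2 * C₂ * L),
    ← hL] at hfin
  have hcs : L ^ 2 ≤ b * ∫ z in (0:ℝ)..b, ‖v'' z‖ ^ 2 :=
    sq_integral_le_mul_integral_sq hb hv''.norm
  have hN0 : 0 ≤ ∫ z in (0:ℝ)..b, ‖v'' z‖ ^ 2 :=
    intervalIntegral.integral_nonneg hb.le fun _ _ => sq_nonneg _
  have hcs' : 2 * C₂ * L ^ 2 ≤ 2 * C₂ * (S * ∫ z in (0:ℝ)..b, ‖v'' z‖ ^ 2) :=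
    mul_le_mul_of_nonneg_left (hcs.trans (mul_le_mul_of_nonneg_right hbS hN0)) (by positivity)
  linarith

section PartialDerivatives

variable {U : Set (ℝ × ℝ)} {f : ℝ → ℝ → ℂ} {r z : ℝ}

lemma hasDerivAt_fst_of_contDiffOn (hU : IsOpen U)
    (hf : ContDiffOn ℝ (⊤ : ℕ∞) (fun p : ℝ × ℝ => f p.1 p.2) U) (h : (r, z) ∈ U) :
    HasDerivAt (fun t => f t z) (fderiv ℝ (fun p : ℝ × ℝ => f p.1 p.2) (r, z) (1, 0)) r := by
  have hd := (hf.contDiffAt (hU.mem_nhds h)).differentiableAt (by simp)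
  exact hd.hasFDerivAt.comp_hasDerivAt (f := fun t : ℝ => (t, z)) r
    ((hasDerivAt_id r).prodMk (hasDerivAt_const r z))

lemma hasDerivAt_snd_of_contDiffOn (hU : IsOpen U)
    (hf : ContDiffOn ℝ (⊤ : ℕ∞) (fun p : ℝ × ℝ => f p.1 p.2) U) (h : (r, z) ∈ U) :
    HasDerivAt (fun w => f r w) (fderiv ℝ (fun p : ℝ × ℝ => f p.1 p.2) (r, z) (0, 1)) z := by
  have hd := (hf.contDiffAt (hU.mem_nhds h)).differentiableAt (by simp)
  exact hd.hasFDerivAt.comp_hasDerivAt (f := fun w : ℝ => (r, w)) z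
    ((hasDerivAt_const z r).prodMk (hasDerivAt_id z))

lemma pr_eq_fderiv (hU : IsOpen U)
    (hf : ContDiffOn ℝ (⊤ : ℕ∞) (fun p : ℝ × ℝ => f p.1 p.2) U) (h : (r, z) ∈ U) :
    pr f r z = fderiv ℝ (fun p : ℝ × ℝ => f p.1 p.2) (r, z) (1, 0) :=
  (hasDerivAt_fst_of_contDiffOn hU hf h).deriv

lemma pz_eq_fderiv (hU : IsOpen U)
    (hf : ContDiffOn ℝ (⊤ : ℕ∞) (fun p : ℝ × ℝ => f p.1 p.2) U) (h : (r, z) ∈ U) :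
    pz f r z = fderiv ℝ (fun p : ℝ × ℝ => f p.1 p.2) (r, z) (0, 1) :=
  (hasDerivAt_snd_of_contDiffOn hU hf h).deriv

lemma hasDerivAt_pr (hU : IsOpen U)
    (hf : ContDiffOn ℝ (⊤ : ℕ∞) (fun p : ℝ × ℝ => f p.1 p.2) U) (h : (r, z) ∈ U) :
    HasDerivAt (fun t => f t z) (pr f r z) r :=
  (hasDerivAt_fst_of_contDiffOn hU hf h).differentiableAt.hasDerivAt

lemma hasDerivAt_pz (hU : IsOpen U)
    (hf : ContDiffOn ℝ (⊤ : ℕ∞) (fun p : ℝ × ℝ => f p.1 p.2) U) (h : (r, z) ∈ U) :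
    HasDerivAt (fun w => f r w) (pz f r z) z :=
  (hasDerivAt_snd_of_contDiffOn hU hf h).differentiableAt.hasDerivAt

lemma contDiffOn_pr (hU : IsOpen U)
    (hf : ContDiffOn ℝ (⊤ : ℕ∞) (fun p : ℝ × ℝ => f p.1 p.2) U) :
    ContDiffOn ℝ (⊤ : ℕ∞) (fun p : ℝ × ℝ => pr f p.1 p.2) U :=
  ((hf.fderiv_of_isOpen hU (m := (⊤ : ℕ∞)) (by simp)).clm_apply contDiffOn_const).congr
    fun _ hp => pr_eq_fderiv hU hf hp

lemma contDiffOn_pz (hU : IsOpen U)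
    (hf : ContDiffOn ℝ (⊤ : ℕ∞) (fun p : ℝ × ℝ => f p.1 p.2) U) :
    ContDiffOn ℝ (⊤ : ℕ∞) (fun p : ℝ × ℝ => pz f p.1 p.2) U :=
  ((hf.fderiv_of_isOpen hU (m := (⊤ : ℕ∞)) (by simp)).clm_apply contDiffOn_const).congr
    fun _ hp => pz_eq_fderiv hU hf hp

lemma pz_congr {g : ℝ → ℝ → ℂ} (hU : IsOpen U)
    (hfg : ∀ p ∈ U, f p.1 p.2 = g p.1 p.2) (h : (r, z) ∈ U) : pz f r z = pz g r z := by
  refine Filter.EventuallyEq.deriv_eq ?_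
  have : ∀ᶠ w in nhds z, (r, w) ∈ U :=
    (Continuous.prodMk_right r).continuousAt.preimage_mem_nhds (hU.mem_nhds h)
  filter_upwards [this] with w hw using hfg _ hw

lemma pz_pr_eq_pr_pz (hU : IsOpen U)
    (hf : ContDiffOn ℝ (⊤ : ℕ∞) (fun p : ℝ × ℝ => f p.1 p.2) U) (h : (r, z) ∈ U) :
    pz (pr f) r z = pr (pz f) r z := by
  set F : ℝ × ℝ → ℂ := fun p => f p.1 p.2 with hF
  have hF' : HasFDerivAt (fderiv ℝ F) (fderiv ℝ (fderiv ℝ F) (r, z)) (r, z) :=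
    ((hf.fderiv_of_isOpen hU (m := (⊤ : ℕ∞)) (by simp)).contDiffAt
      (hU.mem_nhds h)).differentiableAt (by simp) |>.hasFDerivAt
  have key : ∀ c d : ℝ × ℝ, fderiv ℝ (fun p => fderiv ℝ F p c) (r, z) d
      = fderiv ℝ (fderiv ℝ F) (r, z) d c := fun c d => by
    have := (hF'.clm_apply (hasFDerivAt_const c (r, z))).fderiv
    rw [this]
    simp
  have e1 : (fun p : ℝ × ℝ => pr f p.1 p.2) =ᶠ[nhds (r, z)] fun p => fderiv ℝ F p (1, 0) := by
    filter_upwards [hU.mem_nhds h] with p hp using pr_eq_fderiv hU hf hp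
  have e2 : (fun p : ℝ × ℝ => pz f p.1 p.2) =ᶠ[nhds (r, z)] fun p => fderiv ℝ F p (0, 1) := by
    filter_upwards [hU.mem_nhds h] with p hp using pz_eq_fderiv hU hf hp
  rw [pz_eq_fderiv hU (contDiffOn_pr hU hf) h, pr_eq_fderiv hU (contDiffOn_pz hU hf) h,
    e1.fderiv_eq, e2.fderiv_eq, key, key]
  refine ((hf.contDiffAt (hU.mem_nhds h)).isSymmSndFDerivAt ?_) _ _
  simp only [minSmoothness_of_isRCLikeNormedField]
  exact WithTop.coe_le_coe.2 (le_top : (2 : ℕ∞) ≤ ⊤)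

end PartialDerivatives

lemma mem_wgDom {R : ℝ} {s : ℝ → ℝ} {r z : ℝ} (hr : r ∈ Icc 0 R) (hz : z ∈ Icc 0 (s r)) :
    (r, z) ∈ wgDom R s := ⟨hr, hz⟩

lemma continuousOn_slice_of_wgDom {E : Type*} [TopologicalSpace E] {R : ℝ} {s : ℝ → ℝ}
    {f : ℝ → ℝ → E} (hf : ContinuousOn (fun p : ℝ × ℝ => f p.1 p.2) (wgDom R s)) {r : ℝ}
    (hr : r ∈ Icc 0 R) : ContinuousOn (f r) (Icc 0 (s r)) :=
  hf.comp (f := fun z : ℝ => (r, z)) (by fun_prop) fun _ hz => mem_wgDom hr hz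

lemma continuousOn_integral_of_wgDom {R : ℝ} (hR : 0 ≤ R) {s : ℝ → ℝ} (hs : Continuous s)
    (hs0 : ∀ r ∈ Icc 0 R, 0 ≤ s r) {f : ℝ → ℝ → ℝ}
    (hf : ContinuousOn (fun p : ℝ × ℝ => f p.1 p.2) (wgDom R s)) :
    ContinuousOn (fun r => ∫ z in (0:ℝ)..s r, f r z) (Icc 0 R) := by
  set ρ : ℝ → ℝ := fun r => max 0 (min r R) with hρ
  have hρc : Continuous ρ := by fun_prop
  have hρm : ∀ r, ρ r ∈ Icc 0 R := fun r => ⟨le_max_left _ _, max_le hR (min_le_right _ _)⟩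
  have hρe : ∀ r ∈ Icc 0 R, ρ r = r := fun r hr => by
    simp [hρ, hr.1, hr.2]
  set F : ℝ → ℝ → ℝ := fun r z => f (ρ r) (max 0 (min z (s (ρ r)))) with hF
  have hFc : Continuous F.uncurry := by
    refine hf.comp_continuous
      (f := fun p : ℝ × ℝ => (ρ p.1, max 0 (min p.2 (s (ρ p.1))))) (by fun_prop) fun p => ?_
    exact mem_wgDom (hρm _) ⟨le_max_left _ _, max_le (hs0 _ (hρm _)) (min_le_right _ _)⟩
  refine (intervalIntegral.continuous_parametric_intervalIntegral_of_continuous (a₀ := 0)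
    (μ := volume) hFc hs).continuousOn.congr fun r hr => ?_
  refine intervalIntegral.integral_congr fun z hz => ?_
  rw [uIcc_of_le (hs0 r hr)] at hz
  simp [hF, hρe r hr, hz.1, hz.2]

/-- The increment of the integral of a nonnegative function over shrinking intervals. -/
lemma integral_sub_integral_le_of_wgDom {R M : ℝ} {s : ℝ → ℝ} (hs0 : ∀ r ∈ Icc 0 R, 0 ≤ s r)
    (hs : AntitoneOn s (Icc 0 R)) {f f' g : ℝ → ℝ → ℝ}
    (hf : ContinuousOn (fun p : ℝ × ℝ => f p.1 p.2) (wgDom R s))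
    (hf' : ContinuousOn (fun p : ℝ × ℝ => f' p.1 p.2) (wgDom R s))
    (hg : ContinuousOn (fun p : ℝ × ℝ => g p.1 p.2) (wgDom R s))
    (hd : ∀ r ∈ Icc 0 R, ∀ z ∈ Icc 0 (s r), HasDerivAt (fun t => f t z) (f' r z) r)
    (hf0 : ∀ r z, 0 ≤ f r z) (hg0 : ∀ r z, 0 ≤ g r z) (hfg : ∀ r z, f' r z ≤ g r z)
    {a b : ℝ} (ha : 0 ≤ a) (hab : a ≤ b) (hb : b ≤ R)
    (hM : ∀ r ∈ Icc a b, ∫ z in (0:ℝ)..s r, g r z ≤ M) :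
    (∫ z in (0:ℝ)..s b, f b z) - (∫ z in (0:ℝ)..s a, f a z) ≤ M * (b - a) := by
  have hmem : ∀ r ∈ Icc a b, r ∈ Icc 0 R := fun r hr => ⟨ha.trans hr.1, hr.2.trans hb⟩
  have hbI : b ∈ Icc a b := ⟨hab, le_rfl⟩
  have haI : a ∈ Icc a b := ⟨le_rfl, hab⟩
  have hsb0 : 0 ≤ s b := hs0 b (hmem b hbI)
  have hsub : ∀ r ∈ Icc a b, s b ≤ s r := fun r hr => hs (hmem r hr) (hmem b hbI) hr.2
  have hsubI : ∀ r ∈ Icc a b, Icc 0 (s b) ⊆ Icc 0 (s r) := fun r hr =>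
    Icc_subset_Icc_right (hsub r hr)
  have hint : ∀ h : ℝ → ℝ → ℝ, ContinuousOn (fun p : ℝ × ℝ => h p.1 p.2) (wgDom R s) →
      ∀ r ∈ Icc a b, IntervalIntegrable (h r) volume 0 (s r) := fun h hh r hr =>
    ContinuousOn.intervalIntegrable_of_Icc (hs0 r (hmem r hr))
      (continuousOn_slice_of_wgDom hh (hmem r hr))
  have hint' : ∀ h : ℝ → ℝ → ℝ, ContinuousOn (fun p : ℝ × ℝ => h p.1 p.2) (wgDom R s) →
      ∀ r ∈ Icc a b, IntervalIntegrable (h r) volume 0 (s b) := fun h hh r hr =>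
    ContinuousOn.intervalIntegrable_of_Icc hsb0
      ((continuousOn_slice_of_wgDom hh (hmem r hr)).mono (hsubI r hr))
  have hrect : Icc a b ×ˢ Icc 0 (s b) ⊆ wgDom R s := fun p hp =>
    ⟨hmem _ hp.1, hsubI _ hp.1 hp.2⟩
  have hmono : ∫ z in (0:ℝ)..s b, f a z ≤ ∫ z in (0:ℝ)..s a, f a z :=
    integral_mono_interval le_rfl hsb0 (hsub a haI) (ae_of_all _ fun z => hf0 a z)
      (hint f hf a haI)
  have hftc : ∀ z ∈ Icc 0 (s b), ∫ t in a..b, f' t z = f b z - f a z := fun z hz => by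
    rw [← uIcc_of_le hab] at hmem hsubI
    refine integral_eq_sub_of_hasDerivAt (f := fun t => f t z)
      (fun t ht => hd t (hmem t ht) z (hsubI t ht hz)) (ContinuousOn.intervalIntegrable ?_)
    exact hf'.comp (f := fun t : ℝ => (t, z)) (by fun_prop) fun t ht =>
      mem_wgDom (hmem t ht) (hsubI t ht hz)
  have hswap : ∫ t in a..b, ∫ z in (0:ℝ)..s b, f' t z
      = ∫ z in (0:ℝ)..s b, ∫ t in a..b, f' t z := by
    refine intervalIntegral_intervalIntegral_swap ?_
    rw [uIoc_of_le hab, uIoc_of_le hsb0]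
    exact ((hf'.mono hrect).integrableOn_compact (isCompact_Icc.prod isCompact_Icc)).mono_set
      (prod_mono Ioc_subset_Icc_self Ioc_subset_Icc_self)
  have hinner : ∀ t ∈ Icc a b, ∫ z in (0:ℝ)..s b, f' t z ≤ M := fun t ht =>
    calc ∫ z in (0:ℝ)..s b, f' t z ≤ ∫ z in (0:ℝ)..s b, g t z :=
          integral_mono_on hsb0 (hint' f' hf' t ht) (hint' g hg t ht) fun z _ => hfg t z
      _ ≤ ∫ z in (0:ℝ)..s t, g t z :=
          integral_mono_interval le_rfl hsb0 (hsub t ht) (ae_of_all _ fun z => hg0 t z)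
            (hint g hg t ht)
      _ ≤ M := hM t ht
  have hcI : ContinuousOn (fun t => ∫ z in (0:ℝ)..s b, f' t z) (Icc a b) := by
    have h := continuousOn_integral_of_wgDom (R := b - a) (s := fun _ => s b)
      (f := fun t z => f' (a + t) z) (sub_nonneg.2 hab) continuous_const (fun _ _ => hsb0)
      (hf'.comp (f := fun p : ℝ × ℝ => (a + p.1, p.2)) (by fun_prop) fun p hp =>
        hrect ⟨⟨by linarith [hp.1.1], by linarith [hp.1.2]⟩, hp.2⟩)
    refine (h.comp (f := fun t : ℝ => t - a) (by fun_prop) fun t ht =>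
      ⟨by linarith [ht.1], by linarith [ht.2]⟩).congr fun t _ => ?_
    simp
  have hout : ∫ t in a..b, ∫ z in (0:ℝ)..s b, f' t z ≤ M * (b - a) := by
    have := integral_mono_on hab (hcI.intervalIntegrable_of_Icc hab)
      (intervalIntegrable_const (μ := volume) (c := M)) hinner
    rwa [intervalIntegral.integral_const, smul_eq_mul, mul_comm] at this
  calc (∫ z in (0:ℝ)..s b, f b z) - (∫ z in (0:ℝ)..s a, f a z)
      ≤ (∫ z in (0:ℝ)..s b, f b z) - ∫ z in (0:ℝ)..s b, f a z := by linarith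
    _ = ∫ z in (0:ℝ)..s b, (f b z - f a z) :=
        (intervalIntegral.integral_sub (hint' f hf b hbI) (hint' f hf a haI)).symm
    _ = ∫ z in (0:ℝ)..s b, ∫ t in a..b, f' t z :=
        intervalIntegral.integral_congr fun z hz =>
          (hftc z (by rwa [uIcc_of_le hsb0] at hz)).symm
    _ ≤ M * (b - a) := hswap ▸ hout

/-- Grönwall's inequality for the integral of a nonnegative function over shrinking intervals. -/
lemma integral_le_exp_mul_of_wgDom {R K : ℝ} (hR : 0 ≤ R) {s : ℝ → ℝ}
    (hsc : Continuous s) (hs0 : ∀ r ∈ Icc 0 R, 0 ≤ s r) (hs : AntitoneOn s (Icc 0 R))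
    {f f' g : ℝ → ℝ → ℝ}
    (hf : ContinuousOn (fun p : ℝ × ℝ => f p.1 p.2) (wgDom R s))
    (hf' : ContinuousOn (fun p : ℝ × ℝ => f' p.1 p.2) (wgDom R s))
    (hg : ContinuousOn (fun p : ℝ × ℝ => g p.1 p.2) (wgDom R s))
    (hd : ∀ r ∈ Icc 0 R, ∀ z ∈ Icc 0 (s r), HasDerivAt (fun t => f t z) (f' r z) r)
    (hf0 : ∀ r z, 0 ≤ f r z) (hg0 : ∀ r z, 0 ≤ g r z) (hfg : ∀ r z, f' r z ≤ g r z)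
    (hK : ∀ r ∈ Icc 0 R, ∫ z in (0:ℝ)..s r, g r z ≤ K * ∫ z in (0:ℝ)..s r, f r z)
    {r : ℝ} (hr : r ∈ Icc 0 R) :
    ∫ z in (0:ℝ)..s r, f r z ≤ (∫ z in (0:ℝ)..s 0, f 0 z) * Real.exp (K * r) := by
  have hc := continuousOn_integral_of_wgDom hR hsc hs0 hf
  have h := le_gronwallBound_of_liminf_deriv_right_le
    (f := fun r => ∫ z in (0:ℝ)..s r, f r z) (f' := fun r => K * ∫ z in (0:ℝ)..s r, f r z)
    (δ := ∫ z in (0:ℝ)..s 0, f 0 z) (K := K) (ε := 0) hc ?_ le_rfl (fun x _ => by simp) r hr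
  · rwa [gronwallBound_ε0, sub_zero] at h
  intro x hx m hm
  obtain ⟨m', hm', hm'm⟩ := exists_between hm
  have hev : ∀ᶠ y in nhdsWithin x (Icc 0 R), K * ∫ z in (0:ℝ)..s y, f y z < m' :=
    ((hc x ⟨hx.1, hx.2.le⟩).const_mul K).eventually_lt_const hm'
  obtain ⟨δ, hδ, hball⟩ := Metric.mem_nhdsWithin_iff.1 hev
  have hpos : x < min (x + δ) R := lt_min (by linarith) hx.2
  refine (Filter.Eventually.frequently ?_)
  filter_upwards [Ioo_mem_nhdsGT hpos] with y hy
  have hyδ : y < x + δ := hy.2.trans_le (min_le_left _ _)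
  have hyR : y < R := hy.2.trans_le (min_le_right _ _)
  have hinc := integral_sub_integral_le_of_wgDom (M := m') hs0 hs hf hf' hg hd hf0 hg0 hfg hx.1
    hy.1.le hyR.le fun t ht => by
      have htR : t ∈ Icc 0 R := ⟨hx.1.trans ht.1, ht.2.trans hyR.le⟩
      refine (hK t htR).trans (le_of_lt (hball ⟨?_, htR⟩))
      rw [Metric.mem_ball, Real.dist_eq, abs_of_nonneg (by linarith [ht.1])]
      linarith [ht.2]
  rw [inv_mul_lt_iff₀ (sub_pos.2 hy.1)]
  nlinarith [hy.1]

/-- On an interval of bounded length, the `H²` norm of a function vanishing at both endpoints is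
controlled by the `L²` norm of its second derivative. -/
lemma integral_sq_add_le_of_dirichlet {b S : ℝ} (hb : 0 < b) (hbS : b ≤ S) {f f' f'' : ℝ → ℂ}
    (hf : ∀ z ∈ Icc 0 b, HasDerivAt f (f' z) z) (hf' : ∀ z ∈ Icc 0 b, HasDerivAt f' (f'' z) z)
    (hf'' : ContinuousOn f'' (Icc 0 b)) (h0 : f 0 = 0) (h1 : f b = 0) :
    (∫ z in (0:ℝ)..b, ‖f z‖ ^ 2) + (∫ z in (0:ℝ)..b, ‖f' z‖ ^ 2) + (∫ z in (0:ℝ)..b, ‖f'' z‖ ^ 2)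
      ≤ (S ^ 4 + S ^ 2 + 1) * ∫ z in (0:ℝ)..b, ‖f'' z‖ ^ 2 := by
  have hS : 0 ≤ S := hb.le.trans hbS
  have hcs := sq_integral_le_mul_integral_sq hb hf''.norm
  set L := ∫ t in (0:ℝ)..b, ‖f'' t‖ with hL
  set N := ∫ t in (0:ℝ)..b, ‖f'' t‖ ^ 2 with hN
  have hL0 : 0 ≤ L := intervalIntegral.integral_nonneg hb.le fun _ _ => norm_nonneg _
  have hN0 : 0 ≤ N := intervalIntegral.integral_nonneg hb.le fun _ _ => sq_nonneg _
  have hconst : ∀ (h : ℝ → ℂ) (C : ℝ), ContinuousOn h (Icc 0 b) →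
      (∀ z ∈ Icc 0 b, ‖h z‖ ≤ C) → ∫ z in (0:ℝ)..b, ‖h z‖ ^ 2 ≤ b * C ^ 2 := fun h C hc hle => by
    have := integral_mono_on hb.le ((hc.norm.pow 2).intervalIntegrable_of_Icc hb.le)
      (intervalIntegrable_const (μ := volume) (c := C ^ 2))
      fun z hz => pow_le_pow_left₀ (norm_nonneg _) (hle z hz) 2
    simpa using this
  have e1 := hconst f (b * L) (HasDerivAt.continuousOn hf) fun z hz =>
    (norm_le_of_dirichlet hb hf hf' hf'' h0 h1 hz).2
  have e2 := hconst f' L (HasDerivAt.continuousOn hf') fun z hz =>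
    (norm_le_of_dirichlet hb hf hf' hf'' h0 h1 hz).1
  have e3 : b * L ^ 2 ≤ S ^ 2 * N := by
    calc b * L ^ 2 ≤ b * (b * N) := mul_le_mul_of_nonneg_left hcs hb.le
      _ = b ^ 2 * N := by ring
      _ ≤ S ^ 2 * N := by gcongr
  have e4 : b * (b * L) ^ 2 ≤ S ^ 4 * N := by
    calc b * (b * L) ^ 2 = b ^ 2 * (b * L ^ 2) := by ring
      _ ≤ S ^ 2 * (S ^ 2 * N) := by gcongr
      _ = S ^ 4 * N := by ring
  linarith

/-- A function vanishing on `[0, R]` has zero derivative there. -/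
lemma hasDerivAt_eq_zero_of_eqOn_Icc {R : ℝ} (hR : 0 < R) {f : ℝ → ℂ} {f' : ℂ} {r : ℝ}
    (hr : r ∈ Icc 0 R) (hf : HasDerivAt f f' r) (h0 : ∀ t ∈ Icc 0 R, f t = 0) : f' = 0 :=
  (uniqueDiffOn_Icc hR r hr).eq_deriv _ hf.hasDerivWithinAt
    ((hasDerivWithinAt_const r _ (0 : ℂ)).congr h0 (h0 r hr))

/-- Solving the wide-angle equation for `v_{zzr}`. -/
lemma norm_le_of_wide_angle {α lam B : ℝ} (hα : 0 < α) {q β u w v x : ℂ} (hq : q ≠ 0)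
    (hβ : ‖β‖ ≤ B)
    (h : (1 + q * β) * u + (α : ℂ) ^ 2 * q * x
      = Complex.I * (lam : ℂ) * ((α : ℂ) ^ 2 * w + β * v)) :
    ‖x‖ ≤ |lam| / ‖q‖ * ‖w‖ + |lam| * B / (α ^ 2 * ‖q‖) * ‖v‖
      + (1 + ‖q‖ * B) / (α ^ 2 * ‖q‖) * ‖u‖ := by
  have hq' : 0 < ‖q‖ := norm_pos_iff.2 hq
  have hx : (α : ℂ) ^ 2 * q * x = Complex.I * (lam : ℂ) * ((α : ℂ) ^ 2 * w)
      + Complex.I * (lam : ℂ) * (β * v) - (1 + q * β) * u := by linear_combination h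
  have hn : α ^ 2 * ‖q‖ * ‖x‖
      ≤ |lam| * (α ^ 2 * ‖w‖) + |lam| * (B * ‖v‖) + (1 + ‖q‖ * B) * ‖u‖ := by
    have e : ‖(α : ℂ) ^ 2 * q * x‖ = α ^ 2 * ‖q‖ * ‖x‖ := by simp
    rw [← e, hx]
    refine (norm_sub_le _ _).trans (add_le_add ((norm_add_le _ _).trans (add_le_add ?_ ?_)) ?_)
    · simp
    · simp only [norm_mul, Complex.norm_I, Complex.norm_real, Real.norm_eq_abs, one_mul]
      gcongr
    · rw [norm_mul]
      gcongr
      refine (norm_add_le _ _).trans ?_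
      rw [norm_one, norm_mul]
      gcongr
  have hpos : 0 < α ^ 2 * ‖q‖ := by positivity
  refine le_of_mul_le_mul_left (hn.trans (le_of_eq ?_)) hpos
  field_simp

/-- `H²`-stability for an upsloping bottom: there are `ε > 0` and `c > 0`,
depending only on `α, q, λ, R`, on upper bounds `Ms, Mds` for `s` and `|ṡ|`,
and on an upper bound `Mβ` for `β` and its first-order partial derivatives,
such that if `ṡ ≤ 0` on `[0,R]` and `(1/α)·max s ≤ ε`, then every smooth
solution of the wide-angle equation with `v(r,0) = v(r,s(r)) = 0` satisfies
`‖v(r,·)‖₂ ≤ c ‖v(0,·)‖₂` on `[0,R]`. -/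
theorem stmt_5 (R α : ℝ) (q : ℂ) (lam : ℝ)
    (hR : 0 < R) (hα : 0 < α) (hq : q ≠ 0) (hlam : lam ≠ 0) (Ms Mds Mβ : ℝ) :
    ∃ ε > (0:ℝ), ∃ c > (0:ℝ),
      ∀ (s : ℝ → ℝ) (β : ℝ → ℝ → ℂ),
        ContDiff ℝ 1 s → (∀ r ∈ Icc (0:ℝ) R, 0 < s r) →
        (∀ r ∈ Icc (0:ℝ) R, deriv s r ≤ 0) →
        (∀ r ∈ Icc (0:ℝ) R, s r ≤ Ms ∧ |deriv s r| ≤ Mds) →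
        SmoothNearDom R s β →
        (∀ r ∈ Icc (0:ℝ) R, ∀ z ∈ Icc (0:ℝ) (s r),
          ‖β r z‖ ≤ Mβ ∧ ‖pr β r z‖ ≤ Mβ ∧ ‖pz β r z‖ ≤ Mβ) →
        (∀ r ∈ Icc (0:ℝ) R, (1 / α) * s r ≤ ε) →
        ∀ v : ℝ → ℝ → ℂ, SmoothNearDom R s v →
          (∀ r ∈ Icc (0:ℝ) R, ∀ z ∈ Icc (0:ℝ) (s r),
            (1 + q * β r z) * pr v r z + (α : ℂ) ^ 2 * q * pr (pz (pz v)) r z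
              = Complex.I * (lam : ℂ) * ((α : ℂ) ^ 2 * pz (pz v) r z + β r z * v r z)) →
          (∀ r ∈ Icc (0:ℝ) R, v r 0 = 0) →
          (∀ r ∈ Icc (0:ℝ) R, v r (s r) = 0) →
          ∀ r ∈ Icc (0:ℝ) R, H2norm s v r ≤ c * H2norm s v 0 := by
  set B : ℝ := |Mβ| with hB
  set ε : ℝ := Real.sqrt (‖q‖ / (2 * (1 + ‖q‖ * B))) with hε
  have hq' : 0 < ‖q‖ := norm_pos_iff.2 hq
  have hB0 : 0 ≤ B := abs_nonneg _
  have hε0 : 0 < ε := Real.sqrt_pos.2 (by positivity)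
  set S : ℝ := ε * α with hS
  have hsmall : (1 + ‖q‖ * B) / (α ^ 2 * ‖q‖) * S ^ 2 ≤ 1 / 2 := by
    rw [hS, mul_pow, hε, Real.sq_sqrt (by positivity)]
    refine le_of_eq ?_
    have : 1 + ‖q‖ * B ≠ 0 := by positivity
    field_simp
  obtain ⟨K, hK0, hK⟩ := exists_integral_mul_le_of_dirichlet (S := S) (a := |lam| / ‖q‖)
    (e := |lam| * B / (α ^ 2 * ‖q‖)) (Γ := (1 + ‖q‖ * B) / (α ^ 2 * ‖q‖)) (D := |Mds|)
    (by positivity) (by positivity) (by positivity) (by positivity) (by positivity) hsmall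
  refine ⟨ε, hε0, Real.sqrt ((S ^ 4 + S ^ 2 + 1) * Real.exp (K * R)),
    Real.sqrt_pos.2 (by positivity), ?_⟩
  intro s β hs hs0 hs' hsM _ hβ hsε v hv heq hv0 hvs r hr
  obtain ⟨U, hU, hDU, hvU⟩ := hv
  have hmem : ∀ t ∈ Icc 0 R, ∀ z ∈ Icc 0 (s t), (t, z) ∈ U := fun t ht z hz =>
    hDU (mem_wgDom ht hz)
  have hvz := contDiffOn_pz hU hvU
  have hvzz := contDiffOn_pz hU hvz
  have hvr := contDiffOn_pr hU hvU
  have hvrz := contDiffOn_pz hU hvr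
  have hvzzr := contDiffOn_pr hU hvzz
  have hcomm : ∀ p ∈ U, pz (pz (pr v)) p.1 p.2 = pr (pz (pz v)) p.1 p.2 := fun p hp => by
    rw [pz_congr hU (fun p hp => pz_pr_eq_pr_pz hU hvU hp) hp, pz_pr_eq_pr_pz hU hvz hp]
  have hsS : ∀ t ∈ Icc 0 R, s t ≤ S := fun t ht => by
    have := hsε t ht
    rwa [one_div_mul_eq_div, div_le_iff₀ hα] at this
  have hsanti : AntitoneOn s (Icc 0 R) :=
    antitoneOn_of_deriv_nonpos (convex_Icc 0 R) hs.continuous.continuousOn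
      (hs.differentiable one_ne_zero).differentiableOn
      fun t ht => hs' t (interior_subset ht)
  have hbdry : ∀ t ∈ Icc 0 R, ‖pr v t (s t)‖ ≤ |Mds| * ‖pz v t (s t)‖ := fun t ht => by
    have hts : (t, s t) ∈ U := hmem t ht _ ⟨(hs0 t ht).le, le_rfl⟩
    have hF := ((hvU.contDiffAt (hU.mem_nhds hts)).differentiableAt (by simp)).hasFDerivAt
    have hsd := (hs.differentiable one_ne_zero t).hasDerivAt
    have h0 := hasDerivAt_eq_zero_of_eqOn_Icc hR ht
      (hF.comp_hasDerivAt (f := fun x : ℝ => (x, s x)) t ((hasDerivAt_id t).prodMk hsd)) hvs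
    have hsplit : ((1 : ℝ), deriv s t) = (1, 0) + deriv s t • ((0 : ℝ), (1 : ℝ)) := by simp
    rw [hsplit, map_add, map_smul, ← pr_eq_fderiv hU hvU hts, ← pz_eq_fderiv hU hvU hts] at h0
    rw [eq_neg_of_add_eq_zero_left h0, norm_neg, norm_smul, Real.norm_eq_abs]
    exact mul_le_mul_of_nonneg_right ((hsM t ht).2.trans (le_abs_self _)) (norm_nonneg _)
  have hdz : ∀ {f : ℝ → ℝ → ℂ}, ContDiffOn ℝ (⊤ : ℕ∞) (fun p : ℝ × ℝ => f p.1 p.2) U →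
      ∀ t ∈ Icc 0 R, ∀ z ∈ Icc 0 (s t), HasDerivAt (f t) (pz f t z) z := fun hf t ht z hz =>
    hasDerivAt_pz hU hf (hmem t ht z hz)
  have henergy : ∀ t ∈ Icc 0 R,
      ∫ z in (0:ℝ)..s t, 2 * (‖pr (pz (pz v)) t z‖ * ‖pz (pz v) t z‖)
        ≤ K * ∫ z in (0:ℝ)..s t, ‖pz (pz v) t z‖ ^ 2 := fun t ht => by
    refine hK (s t) (hs0 t ht) (hsS t ht) (v t) (pz v t) (pz (pz v) t) (pr v t) (pz (pr v) t)
      (pr (pz (pz v)) t) (hdz hvU t ht) (hdz hvz t ht)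
      (continuousOn_slice_of_wgDom (hvzz.continuousOn.mono hDU) ht) (hdz hvr t ht)
      (fun z hz => hcomm _ (hmem t ht z hz) ▸ hdz hvrz t ht z hz)
      (continuousOn_slice_of_wgDom (hvzzr.continuousOn.mono hDU) ht) (hv0 t ht) (hvs t ht)
      (hasDerivAt_eq_zero_of_eqOn_Icc hR ht
        (hasDerivAt_pr hU hvU (hmem t ht 0 ⟨le_rfl, (hs0 t ht).le⟩)) hv0)
      (hbdry t ht) fun z hz => ?_
    exact norm_le_of_wide_angle hα hq ((hβ t ht z hz).1.trans (le_abs_self _)) (heq t ht z hz)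
  have cw := hvzz.continuousOn.mono hDU
  have cwr := hvzzr.continuousOn.mono hDU
  have hgrow := integral_le_exp_mul_of_wgDom (K := K) hR.le hs.continuous
    (fun t ht => (hs0 t ht).le) hsanti
    (f := fun t z => ‖pz (pz v) t z‖ ^ 2)
    (f' := fun t z => 2 * inner ℝ (pz (pz v) t z) (pr (pz (pz v)) t z))
    (g := fun t z => 2 * (‖pr (pz (pz v)) t z‖ * ‖pz (pz v) t z‖))
    (cw.norm.pow 2) (continuousOn_const.mul (cw.inner cwr))
    (continuousOn_const.mul (cwr.norm.mul cw.norm))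
    (fun t ht z hz => (hasDerivAt_pr hU hvzz (hmem t ht z hz)).norm_sq)
    (fun _ _ => by positivity) (fun _ _ => by positivity)
    (fun t z => by
      have := real_inner_le_norm (pz (pz v) t z) (pr (pz (pz v)) t z)
      linarith [mul_comm ‖pz (pz v) t z‖ ‖pr (pz (pz v)) t z‖])
    henergy hr
  have hH2 := integral_sq_add_le_of_dirichlet (hs0 r hr) (hsS r hr) (hdz hvU r hr) (hdz hvz r hr)
    (continuousOn_slice_of_wgDom cw hr) (hv0 r hr) (hvs r hr)
  have h00 : (0 : ℝ) ∈ Icc 0 R := ⟨le_rfl, hR.le⟩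
  have hnn : ∀ f : ℝ → ℂ, 0 ≤ ∫ z in (0:ℝ)..s 0, ‖f z‖ ^ 2 := fun f =>
    intervalIntegral.integral_nonneg (hs0 0 h00).le fun _ _ => sq_nonneg _
  have hexp : Real.exp (K * r) ≤ Real.exp (K * R) :=
    Real.exp_le_exp.2 (mul_le_mul_of_nonneg_left hr.2 hK0)
  rw [H2norm, H2norm, ← Real.sqrt_mul (by positivity)]
  refine Real.sqrt_le_sqrt (hH2.trans ?_)
  rw [mul_assoc]
  refine mul_le_mul_of_nonneg_left (hgrow.trans ?_) (by positivity)
  rw [mul_comm]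
  refine mul_le_mul hexp ?_ (hnn _) (Real.exp_pos _).le
  linarith [hnn (v 0), hnn (pz v 0)]
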